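/- Let A, B, C be nonempty finite types and ψ : A × B × C → ℂ a unit vector, with pure state P = |ψ⟩⟨ψ| and marginals ψ^{AC} = Tr_B P, ψ^{BC} = Tr_A P, ψ^{A} = Tr_{BC} P, ψ^{B} = Tr_{AC} P. Define H_ψ(C|A) = H(ψ^{AC}) − H(ψ^{A}) and H_ψ(C|B) = H(ψ^{BC}) − H(ψ^{B}). Then H_ψ(C|A) + H_ψ(C|B) = 0; consequently, either H_ψ(C|A) = H_ψ(C|B) = 0, or at least one of H_ψ(C|A), H_ψ(C|B) is negative. -/

import Mathlib

open Matrix BigOperators Finset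
open scoped ComplexOrder

noncomputable section

/-- Rank-one projector `|v⟩⟨v|`. -/
def outer {I : Type*} (v : I → ℂ) : Matrix I I ℂ :=
  Matrix.of fun i j => v i * star (v j)

open scoped Classical in
/-- Von Neumann entropy of a (Hermitian) matrix: `∑ i, -λ i * log (λ i)` over
its eigenvalues (junk value `0` for non-Hermitian matrices). -/
def vN {I : Type*} [Fintype I] [DecidableEq I] (ρ : Matrix I I ℂ) : ℝ :=
  if h : ρ.IsHermitian then ∑ i, Real.negMulLog (h.eigenvalues i) else 0

/-- Partial trace over `B`: the marginal on `A × C`. -/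
def trB {A B C : Type*} [Fintype B] (M : Matrix (A × B × C) (A × B × C) ℂ) :
    Matrix (A × C) (A × C) ℂ :=
  Matrix.of fun p q => ∑ b, M (p.1, b, p.2) (q.1, b, q.2)

/-- Partial trace over `A`: the marginal on `B × C`. -/
def trA {A B C : Type*} [Fintype A] (M : Matrix (A × B × C) (A × B × C) ℂ) :
    Matrix (B × C) (B × C) ℂ :=
  Matrix.of fun p q => ∑ a, M (a, p) (a, q)

/-- Partial trace over `B` and `C`: the marginal on `A`. -/
def trBC {A B C : Type*} [Fintype B] [Fintype C]
    (M : Matrix (A × B × C) (A × B × C) ℂ) : Matrix A A ℂ :=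
  Matrix.of fun a a' => ∑ b, ∑ c, M (a, b, c) (a', b, c)

/-- Partial trace over `A` and `C`: the marginal on `B`. -/
def trAC {A B C : Type*} [Fintype A] [Fintype C]
    (M : Matrix (A × B × C) (A × B × C) ℂ) : Matrix B B ℂ :=
  Matrix.of fun b b' => ∑ a, ∑ c, M (a, b, c) (a, b', c)

/-- The von Neumann entropy as a sum over the roots of the characteristic polynomial. -/
theorem vN_eq_sum_roots_charpoly {I : Type*} [Fintype I] [DecidableEq I] {ρ : Matrix I I ℂ}
    (h : ρ.IsHermitian) :
    vN ρ = (ρ.charpoly.roots.map fun z => Real.negMulLog z.re).sum := by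
  simp [vN, h, h.roots_charpoly_eq_eigenvalues]

/-- The two Gram matrices of a rectangular matrix have the same von Neumann entropy. -/
theorem vN_mul_conjTranspose {I J : Type*} [Fintype I] [DecidableEq I] [Fintype J]
    [DecidableEq J] (M : Matrix I J ℂ) : vN (M * Mᴴ) = vN (Mᴴ * M)ᵀ := by
  rw [vN_eq_sum_roots_charpoly (isHermitian_mul_conjTranspose_self M),
    vN_eq_sum_roots_charpoly (isHermitian_conjTranspose_mul_self M).transpose,
    charpoly_transpose]
  have h := congrArg
    (fun p : Polynomial ℂ => (p.roots.map fun z => Real.negMulLog z.re).sum)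
    (charpoly_mul_comm' M Mᴴ)
  simpa [Polynomial.roots_mul, Polynomial.X_ne_zero, (charpoly_monic _).ne_zero,
    Multiset.map_nsmul, Multiset.sum_nsmul] using h

/-- Complementary marginals of a pure state, traced over `B` and over `A × C`, have equal
entropy. -/
theorem vN_trB_outer_eq_vN_trAC_outer {A B C : Type*} [Fintype A] [Fintype B] [Fintype C]
    [DecidableEq A] [DecidableEq B] [DecidableEq C] (ψ : A × B × C → ℂ) :
    vN (trB (outer ψ)) = vN (trAC (outer ψ)) := by
  let M : Matrix (A × C) B ℂ := Matrix.of fun p b => ψ (p.1, b, p.2)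
  have hB : trB (outer ψ) = M * Mᴴ := by
    ext p q
    simp [trB, outer, M, Matrix.mul_apply]
  have hAC : trAC (outer ψ) = (Mᴴ * M)ᵀ := by
    ext b b'
    simp [trAC, outer, M, Matrix.mul_apply, Fintype.sum_prod_type, mul_comm]
  rw [hB, hAC, vN_mul_conjTranspose]

/-- Complementary marginals of a pure state, traced over `A` and over `B × C`, have equal
entropy. -/
theorem vN_trA_outer_eq_vN_trBC_outer {A B C : Type*} [Fintype A] [Fintype B] [Fintype C]
    [DecidableEq A] [DecidableEq B] [DecidableEq C] (ψ : A × B × C → ℂ) :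
    vN (trA (outer ψ)) = vN (trBC (outer ψ)) := by
  let M : Matrix (B × C) A ℂ := Matrix.of fun p a => ψ (a, p)
  have hA : trA (outer ψ) = M * Mᴴ := by
    ext p q
    simp [trA, outer, M, Matrix.mul_apply]
  have hBC : trBC (outer ψ) = (Mᴴ * M)ᵀ := by
    ext a a'
    simp [trBC, outer, M, Matrix.mul_apply, Fintype.sum_prod_type, mul_comm]
  rw [hA, hBC, vN_mul_conjTranspose]

/-- For a tripartite pure state `ψ`, the conditional entropies
`H_ψ(C|A) = H(ψ^{AC}) - H(ψ^A)` and `H_ψ(C|B) = H(ψ^{BC}) - H(ψ^B)` sum to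
zero; consequently, either both vanish or at least one of them is negative. -/
theorem conditional_entropies_sum_zero {A B C : Type*}
    [Fintype A] [Fintype B] [Fintype C]
    [DecidableEq A] [DecidableEq B] [DecidableEq C]
    [Nonempty A] [Nonempty B] [Nonempty C]
    (ψ : A × B × C → ℂ) (hψ : ∑ i, ‖ψ i‖ ^ 2 = 1) :
    (vN (trB (outer ψ)) - vN (trBC (outer ψ)))
        + (vN (trA (outer ψ)) - vN (trAC (outer ψ))) = 0 ∧
      ((vN (trB (outer ψ)) - vN (trBC (outer ψ)) = 0 ∧
          vN (trA (outer ψ)) - vN (trAC (outer ψ)) = 0) ∨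
        vN (trB (outer ψ)) - vN (trBC (outer ψ)) < 0 ∨
        vN (trA (outer ψ)) - vN (trAC (outer ψ)) < 0) := by
  rw [vN_trB_outer_eq_vN_trAC_outer, vN_trA_outer_eq_vN_trBC_outer]
  refine ⟨by ring, ?_⟩
  rcases lt_trichotomy (vN (trAC (outer ψ))) (vN (trBC (outer ψ))) with h | h | h
  · exact Or.inr (Or.inl (by linarith))
  · exact Or.inl ⟨by linarith, by linarith⟩
  · exact Or.inr (Or.inr (by linarith))
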